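/- arXiv:2004.03724 — 2 statements merged into one kernel-verified Lean document; each statement's English description precedes it below -/
import Mathlib

section
/- There is an absolute constant c₁ > 0 (one may take c₁ = 1/800) such that for each b ∈ (0, π], each n ∈ ℕ, every affine function l(x) = αx + β (α, β ∈ ℝ) and every trigonometric polynomial T of degree ≤ n, one has max_{|x| ≤ b} | |x| + l(x) − T(x) | ≥ c₁ b / n. -/
noncomputable section

/-- `T ∈ 𝒯_n`: a real trigonometric polynomial of degree at most `n`. -/
def IsTrigPoly (n : ℕ) (T : ℝ → ℝ) : Prop :=
  ∃ a b : ℕ → ℝ, ∀ t : ℝ,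
    T t = a 0 + ∑ k ∈ Finset.Icc 1 n, (a k * Real.cos (k * t) + b k * Real.sin (k * t))

/-- The function `arcsin w / w ^ 2 - 1 / (2 w)`. -/
def arcsinRemainder (w : ℝ) : ℝ := Real.arcsin w / w ^ 2 - 1 / (2 * w)

lemma le_arcsin_self {w : ℝ} (h0 : 0 ≤ w) (h1 : w ≤ 1) : w ≤ Real.arcsin w := by
  have h := Real.sin_le (Real.arcsin_nonneg.2 h0)
  rwa [Real.sin_arcsin (by linarith) h1] at h

lemma one_div_sqrt_one_sub_sq_le {w : ℝ} (hw : w ∈ Set.Ioo (0 : ℝ) (11 / 20)) :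
    1 / √(1 - w ^ 2) ≤ 6 / 5 := by
  have h : (5 / 6 : ℝ) ≤ √(1 - w ^ 2) := Real.le_sqrt_of_sq_le (by nlinarith [hw.1, hw.2])
  rw [div_le_iff₀ (by linarith)]
  linarith

lemma hasDerivAt_arcsinRemainder {w : ℝ} (hw : w ∈ Set.Ioo (0 : ℝ) (11 / 20)) :
    HasDerivAt arcsinRemainder
      (1 / √(1 - w ^ 2) / w ^ 2 - 2 * Real.arcsin w / w ^ 3 + 1 / (2 * w ^ 2)) w := by
  have hw0 : w ≠ 0 := hw.1.ne'
  have hA := Real.hasDerivAt_arcsin (x := w) (by linarith [hw.1]) (by linarith [hw.2])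
  have h1 := hA.div (hasDerivAt_pow 2 w) (by positivity)
  have h2 := (hasDerivAt_const w (1 : ℝ)).div ((hasDerivAt_id w).const_mul 2)
    (by simpa using hw0)
  refine (h1.sub h2).congr_deriv ?_
  generalize 1 / √(1 - w ^ 2) = r
  simp
  field_simp
  ring

lemma hasDerivAt_one_div_sqrt_one_sub_sq {w : ℝ} (hw : w ∈ Set.Ioo (0 : ℝ) (11 / 20)) :
    HasDerivAt (fun w : ℝ => 1 / √(1 - w ^ 2)) (w * (1 / √(1 - w ^ 2)) ^ 3) w := by
  have hpos : 0 < 1 - w ^ 2 := by nlinarith [hw.1, hw.2]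
  have h1 := (((hasDerivAt_pow 2 w).const_sub 1).sqrt hpos.ne')
  have h2 := (hasDerivAt_const w (1 : ℝ)).div h1 (Real.sqrt_pos.2 hpos).ne'
  refine h2.congr_deriv ?_
  have h3 := (Real.sqrt_pos.2 hpos).ne'
  field_simp
  push_cast
  ring

lemma hasDerivAt_deriv_arcsinRemainder {w : ℝ} (hw : w ∈ Set.Ioo (0 : ℝ) (11 / 20)) :
    HasDerivAt
      (fun w : ℝ => 1 / √(1 - w ^ 2) / w ^ 2 - 2 * Real.arcsin w / w ^ 3 + 1 / (2 * w ^ 2))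
      ((1 / √(1 - w ^ 2)) ^ 3 / w - 4 * (1 / √(1 - w ^ 2)) / w ^ 3 + 6 * Real.arcsin w / w ^ 4
        - 1 / w ^ 3) w := by
  have hw0 : w ≠ 0 := hw.1.ne'
  have hA := Real.hasDerivAt_arcsin (x := w) (by linarith [hw.1]) (by linarith [hw.2])
  have h1 := (hasDerivAt_one_div_sqrt_one_sub_sq hw).div (hasDerivAt_pow 2 w) (by positivity)
  have h2 := (hA.const_mul 2).div (hasDerivAt_pow 3 w) (by positivity)
  have h3 := (hasDerivAt_const w (1 : ℝ)).div ((hasDerivAt_pow 2 w).const_mul 2)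
    (by positivity)
  refine ((h1.sub h2).add h3).congr_deriv ?_
  generalize 1 / √(1 - w ^ 2) = r
  simp
  field_simp
  ring

lemma antitoneOn_arcsinRemainder : AntitoneOn arcsinRemainder (Set.Ioo 0 (11 / 20)) := by
  refine antitoneOn_of_deriv_nonpos (convex_Ioo _ _)
    (fun w hw => (hasDerivAt_arcsinRemainder hw).continuousAt.continuousWithinAt) ?_ ?_
  · rw [interior_Ioo]
    exact fun w hw => (hasDerivAt_arcsinRemainder hw).differentiableAt.differentiableWithinAt
  · rw [interior_Ioo]
    intro w hw
    rw [(hasDerivAt_arcsinRemainder hw).deriv]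
    have hr := one_div_sqrt_one_sub_sq_le hw
    have hA := le_arcsin_self hw.1.le (by linarith [hw.2])
    have hw0 := hw.1
    generalize 1 / √(1 - w ^ 2) = r at *
    have : r / w ^ 2 - 2 * Real.arcsin w / w ^ 3 + 1 / (2 * w ^ 2)
        = (r * w - 2 * Real.arcsin w + w / 2) / w ^ 3 := by
      field_simp
    rw [this]
    exact div_nonpos_of_nonpos_of_nonneg (by nlinarith) (by positivity)

lemma convexOn_arcsinRemainder : ConvexOn ℝ (Set.Ioo 0 (11 / 20)) arcsinRemainder := by
  refine convexOn_of_hasDerivWithinAt2_nonneg (convex_Ioo _ _)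
    (fun w hw => (hasDerivAt_arcsinRemainder hw).continuousAt.continuousWithinAt)
    (fun w hw => (hasDerivAt_arcsinRemainder (interior_subset hw)).hasDerivWithinAt)
    (fun w hw => (hasDerivAt_deriv_arcsinRemainder (interior_subset hw)).hasDerivWithinAt) ?_
  rw [interior_Ioo]
  intro w hw
  have hr := one_div_sqrt_one_sub_sq_le hw
  have hr0 : 0 ≤ 1 / √(1 - w ^ 2) := by positivity
  have hA := le_arcsin_self hw.1.le (by linarith [hw.2])
  have hw0 := hw.1
  generalize 1 / √(1 - w ^ 2) = r at *
  have : r ^ 3 / w - 4 * r / w ^ 3 + 6 * Real.arcsin w / w ^ 4 - 1 / w ^ 3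
      = (r ^ 3 * w ^ 3 + (6 * Real.arcsin w - 4 * r * w - w)) / w ^ 4 := by
    field_simp
    ring
  rw [this]
  have h : 0 ≤ 6 * Real.arcsin w - 4 * r * w - w := by nlinarith
  positivity

lemma add_sin_div_two_le_sin {φ δ : ℝ} (h0 : 0 ≤ φ) (h1 : φ ≤ Real.pi) :
    (Real.sin (φ - δ) + Real.sin (φ + δ)) / 2 ≤ Real.sin φ := by
  rw [Real.sin_sub, Real.sin_add]
  nlinarith [Real.sin_nonneg_of_nonneg_of_le_pi h0 h1, Real.cos_le_one δ]

lemma one_div_sin_le_midpoint {φ δ : ℝ} (hδ : 0 ≤ δ) (h0 : 0 < φ - δ) (h1 : φ + δ < Real.pi) :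
    1 / Real.sin φ ≤ (1 / Real.sin (φ - δ) + 1 / Real.sin (φ + δ)) / 2 := by
  have hm := add_sin_div_two_le_sin (φ := φ) (δ := δ) (by linarith) (by linarith)
  have hx := Real.sin_pos_of_pos_of_lt_pi h0 (by linarith)
  have hy := Real.sin_pos_of_pos_of_lt_pi (x := φ + δ) (by linarith) h1
  set x := Real.sin (φ - δ)
  set y := Real.sin (φ + δ)
  calc 1 / Real.sin φ ≤ 1 / ((x + y) / 2) := one_div_le_one_div_of_le (by positivity) hm
    _ ≤ (1 / x + 1 / y) / 2 := by
      rw [div_add_div _ _ hx.ne' hy.ne', div_div, one_div_div, div_le_div_iff₀ (by positivity)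
        (by positivity)]
      nlinarith [sq_nonneg (x - y)]

lemma arcsin_mul_sin_div_sq_midpoint {s φ δ : ℝ} (hs : 0 < s) (hs' : s ≤ 1 / 2) (hδ : 0 ≤ δ)
    (h0 : 0 < φ - δ) (h1 : φ + δ < Real.pi) :
    s / 2 * ((1 / Real.sin (φ - δ) + 1 / Real.sin (φ + δ)) / 2 - 1 / Real.sin φ) ≤
      (Real.arcsin (s * Real.sin (φ - δ)) / Real.sin (φ - δ) ^ 2
        + Real.arcsin (s * Real.sin (φ + δ)) / Real.sin (φ + δ) ^ 2) / 2
      - Real.arcsin (s * Real.sin φ) / Real.sin φ ^ 2 := by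
  have hm := add_sin_div_two_le_sin (φ := φ) (δ := δ) (by linarith) (by linarith)
  have hx := Real.sin_pos_of_pos_of_lt_pi h0 (by linarith)
  have hy := Real.sin_pos_of_pos_of_lt_pi (x := φ + δ) (by linarith) h1
  have hz := Real.sin_pos_of_pos_of_lt_pi (x := φ) (by linarith) (by linarith)
  have hx1 := Real.sin_le_one (φ - δ)
  have hy1 := Real.sin_le_one (φ + δ)
  have hz1 := Real.sin_le_one φ
  set x := Real.sin (φ - δ)
  set y := Real.sin (φ + δ)
  set z := Real.sin φ
  have mem : ∀ {u : ℝ}, 0 < u → u ≤ 1 → s * u ∈ Set.Ioo (0 : ℝ) (11 / 20) := fun hu hu1 =>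
    ⟨by positivity, by nlinarith⟩
  have hanti := antitoneOn_arcsinRemainder (mem (u := (x + y) / 2) (by positivity) (by linarith))
    (mem hz hz1) (mul_le_mul_of_nonneg_left hm hs.le)
  have hconv := convexOn_arcsinRemainder.2 (mem hx hx1) (mem hy hy1)
    (by norm_num : (0 : ℝ) ≤ 1 / 2) (by norm_num : (0 : ℝ) ≤ 1 / 2) (by norm_num)
  have hmid : (1 / 2 : ℝ) • (s * x) + (1 / 2 : ℝ) • (s * y) = s * ((x + y) / 2) := by
    simp only [smul_eq_mul]
    ring
  rw [hmid] at hconv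
  have key : ∀ {u : ℝ}, 0 < u → Real.arcsin (s * u) / u ^ 2
      = s ^ 2 * arcsinRemainder (s * u) + s / 2 * (1 / u) := by
    intro u hu
    unfold arcsinRemainder
    field_simp
    ring
  rw [key hx, key hy, key hz]
  simp only [smul_eq_mul] at hconv
  nlinarith [mul_le_mul_of_nonneg_left (hanti.trans hconv) (sq_nonneg s)]

lemma one_div_sin_midpoint_gap {δ : ℝ} (h0 : 0 < δ) (h1 : δ ≤ Real.pi / 8) :
    1 / (10 * δ) ≤ (1 / Real.sin (2 * δ - δ) + 1 / Real.sin (2 * δ + δ)) / 2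
      - 1 / Real.sin (2 * δ) := by
  have hx := Real.sin_pos_of_pos_of_lt_pi h0 (by linarith [Real.pi_pos])
  have hxδ := Real.sin_le h0.le
  have hc : 9 / 10 ≤ Real.cos δ := by
    have := Real.one_sub_sq_div_two_le_cos (x := δ)
    nlinarith [Real.pi_lt_d2]
  have hc1 := Real.cos_le_one δ
  have e1 : 2 * δ - δ = δ := by ring
  have e2 : Real.sin (2 * δ + δ) = Real.sin δ * (4 * Real.cos δ ^ 2 - 1) := by
    rw [show 2 * δ + δ = 3 * δ by ring, Real.sin_three_mul]
    have := Real.sin_sq_add_cos_sq δ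
    linear_combination (-4) * Real.sin δ * this
  rw [e1, e2, Real.sin_two_mul]
  set x := Real.sin δ
  set c := Real.cos δ
  have hd : 0 < 4 * c ^ 2 - 1 := by nlinarith
  have : (1 / x + 1 / (x * (4 * c ^ 2 - 1))) / 2 - 1 / (2 * x * c)
      = 1 / x * ((1 + 1 / (4 * c ^ 2 - 1)) / 2 - 1 / (2 * c)) := by
    field_simp
  rw [this]
  have h3 : 1 / 3 ≤ 1 / (4 * c ^ 2 - 1) := one_div_le_one_div_of_le hd (by nlinarith)
  have h4 : 1 / (2 * c) ≤ 5 / 9 := by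
    rw [div_le_iff₀ (by linarith)]
    linarith
  have h5 : 1 / δ ≤ 1 / x := one_div_le_one_div_of_le hx hxδ
  have h6 : 0 < 1 / δ := by positivity
  calc 1 / (10 * δ) = 1 / δ * (1 / 10) := by field_simp
    _ ≤ _ := mul_le_mul h5 (by linarith) (by norm_num) (by positivity)

section

open Finset

lemma IsPrimitiveRoot.sum_range_pow_zpow_eq_zero {ζ : ℂ} {N : ℕ} (hζ : IsPrimitiveRoot ζ N)
    {m : ℤ} (hm : ¬ (N : ℤ) ∣ m) : ∑ k ∈ range N, (ζ ^ k) ^ m = 0 := by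
  have h1 : ζ ^ m - 1 ≠ 0 := fun h => hm ((hζ.zpow_eq_one_iff_dvd m).1 (sub_eq_zero.1 h))
  have h2 := mul_geom_sum (ζ ^ m) N
  have h3 : (ζ ^ m) ^ N = 1 := by
    rw [← zpow_natCast, zpow_comm, zpow_natCast, hζ.pow_eq_one, one_zpow]
  rw [h3, sub_self] at h2
  rw [← (mul_eq_zero.1 h2).resolve_left h1]
  refine sum_congr rfl fun k _ => ?_
  rw [← zpow_natCast, ← zpow_natCast, zpow_comm]

lemma normSq_geom_sum {z : ℂ} (hz : ‖z‖ = 1) (p : ℕ) :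
    (Complex.normSq (∑ j ∈ range p, z ^ j) : ℂ)
      = ∑ i ∈ range p, ∑ j ∈ range p, z ^ ((i : ℤ) - j) := by
  have h0 : z ≠ 0 := fun h => by simp [h] at hz
  rw [← Complex.mul_conj, map_sum, sum_mul_sum]
  refine sum_congr rfl fun i _ => sum_congr rfl fun j _ => ?_
  rw [map_pow, ← Complex.inv_eq_conj hz, zpow_sub₀ h0, zpow_natCast, zpow_natCast, inv_pow,
    div_eq_mul_inv]

lemma sum_normSq_geom_sum_mul_zpow {ζ : ℂ} {N : ℕ} (hζ : IsPrimitiveRoot ζ N) (hN : N ≠ 0)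
    (p : ℕ) (m : ℤ) :
    ∑ k ∈ range N, (Complex.normSq (∑ j ∈ range p, (ζ ^ k) ^ j) : ℂ) * (ζ ^ k) ^ m
      = ∑ i ∈ range p, ∑ j ∈ range p, ∑ k ∈ range N, (ζ ^ k) ^ ((i : ℤ) - j + m) := by
  have h0 : ζ ≠ 0 := hζ.ne_zero hN
  have h1 : ‖ζ‖ = 1 := hζ.norm'_eq_one hN
  have : ∀ k ∈ range N, (Complex.normSq (∑ j ∈ range p, (ζ ^ k) ^ j) : ℂ) * (ζ ^ k) ^ m
      = ∑ i ∈ range p, ∑ j ∈ range p, (ζ ^ k) ^ ((i : ℤ) - j + m) := by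
    intro k _
    rw [normSq_geom_sum (by simp [h1]), sum_mul]
    refine sum_congr rfl fun i _ => ?_
    rw [sum_mul]
    exact sum_congr rfl fun j _ => (zpow_add₀ (pow_ne_zero _ h0) _ _).symm
  rw [sum_congr rfl this, sum_comm]
  exact sum_congr rfl fun i _ => sum_comm

lemma sum_normSq_geom_sum {ζ : ℂ} {p : ℕ} (hζ : IsPrimitiveRoot ζ (4 * p)) (hp : 0 < p) :
    ∑ k ∈ range (4 * p), Complex.normSq (∑ j ∈ range p, (ζ ^ k) ^ j) = 4 * (p : ℝ) ^ 2 := by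
  have h := sum_normSq_geom_sum_mul_zpow hζ (by omega) p 0
  have h2 : ∀ i ∈ range p, ∑ j ∈ range p, ∑ k ∈ range (4 * p), (ζ ^ k) ^ ((i : ℤ) - j + 0)
      = 4 * p := by
    intro i hi
    rw [sum_eq_single i]
    · simp
    · intro j hj hji
      refine hζ.sum_range_pow_zpow_eq_zero fun hd => ?_
      have := Int.eq_zero_of_abs_lt_dvd hd (by
        rw [mem_range] at hi hj
        push_cast
        rw [abs_lt]
        omega)
      omega
    · exact fun h => absurd hi h
  rw [sum_congr rfl h2] at h
  simp only [zpow_zero, mul_one, sum_const, card_range, nsmul_eq_mul] at h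
  have h3 : ((∑ k ∈ range (4 * p), Complex.normSq (∑ j ∈ range p, (ζ ^ k) ^ j) : ℝ) : ℂ)
      = ((4 * (p : ℝ) ^ 2 : ℝ) : ℂ) := by
    push_cast
    rw [h]
    ring
  exact_mod_cast h3

lemma IsPrimitiveRoot.pow_two_mul_eq_neg_one {ζ : ℂ} {p : ℕ} (hζ : IsPrimitiveRoot ζ (4 * p))
    (hp : 0 < p) : ζ ^ (2 * p) = -1 :=
  (hζ.pow (b := 2) (by omega) (by ring)).eq_neg_one_of_two_right

lemma sum_alternating_normSq_geom_sum_mul_zpow {ζ : ℂ} {p : ℕ}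
    (hζ : IsPrimitiveRoot ζ (4 * p)) (hp : 0 < p) {m : ℤ} (hm : |m| < p) :
    ∑ k ∈ range (4 * p), (-1) ^ k * (Complex.normSq (∑ j ∈ range p, (ζ ^ k) ^ j) : ℂ)
      * (ζ ^ k) ^ m = 0 := by
  have h0 : ζ ≠ 0 := hζ.ne_zero (by omega)
  have h := sum_normSq_geom_sum_mul_zpow hζ (by omega) p (m + 2 * p)
  rw [sum_eq_zero (s := range p)] at h
  · rw [← h]
    refine sum_congr rfl fun k _ => ?_
    have : (ζ ^ k) ^ (2 * (p : ℤ)) = (-1) ^ k := by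
      rw [← hζ.pow_two_mul_eq_neg_one hp, ← pow_mul, mul_comm (2 * p), pow_mul]
      exact_mod_cast rfl
    rw [zpow_add₀ (pow_ne_zero _ h0), this]
    ring
  · intro i hi
    refine sum_eq_zero fun j hj => hζ.sum_range_pow_zpow_eq_zero fun hd => ?_
    rw [mem_range] at hi hj
    rw [abs_lt] at hm
    push_cast at hd
    obtain ⟨c, hc⟩ := hd
    have h1 : 0 < 4 * (p : ℤ) * c := by omega
    have h2 : 4 * (p : ℤ) * c < 4 * p * 1 := by omega
    have h3 : 0 < c := (mul_pos_iff_of_pos_left (by omega)).1 h1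
    have h4 : c < 1 := lt_of_mul_lt_mul_left h2 (by omega)
    omega

lemma sum_alternating_normSq_geom_sum_mul_eval_re {ζ : ℂ} {p : ℕ}
    (hζ : IsPrimitiveRoot ζ (4 * p)) (hp : 0 < p) {P : Polynomial ℝ} (hP : P.natDegree < p) :
    ∑ k ∈ range (4 * p), (-1) ^ k * Complex.normSq (∑ j ∈ range p, (ζ ^ k) ^ j)
      * P.eval (ζ ^ k).re = 0 := by
  have h0 : ζ ≠ 0 := hζ.ne_zero (by omega)
  have hpow : ∀ q < p, ∑ k ∈ range (4 * p), (-1) ^ k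
      * Complex.normSq (∑ j ∈ range p, (ζ ^ k) ^ j) * (ζ ^ k).re ^ q = 0 := by
    intro q hq
    have hre : ∀ k, (((ζ ^ k).re : ℝ) : ℂ) ^ q
        = ∑ i ∈ range (q + 1), (q.choose i / 2 ^ q : ℂ) * (ζ ^ k) ^ (2 * (i : ℤ) - q) := by
      intro k
      have hk : ‖ζ ^ k‖ = 1 := by simp [hζ.norm'_eq_one (by omega : 4 * p ≠ 0)]
      rw [Complex.re_eq_add_conj, ← Complex.inv_eq_conj hk, div_pow, add_pow, sum_div]
      refine sum_congr rfl fun i hi => ?_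
      rw [mem_range] at hi
      have hz : ζ ^ k ≠ 0 := pow_ne_zero _ h0
      have : (ζ ^ k) ^ (2 * (i : ℤ) - q) = (ζ ^ k) ^ i * (ζ ^ k)⁻¹ ^ (q - i) := by
        rw [← zpow_natCast (ζ ^ k) i, ← zpow_natCast (ζ ^ k)⁻¹, inv_zpow', ← zpow_add₀ hz]
        congr 1
        omega
      rw [this]
      ring
    have : ((∑ k ∈ range (4 * p), (-1) ^ k
        * Complex.normSq (∑ j ∈ range p, (ζ ^ k) ^ j) * (ζ ^ k).re ^ q : ℝ) : ℂ) = 0 := by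
      push_cast
      simp only [hre, mul_sum]
      rw [sum_comm]
      refine sum_eq_zero fun i hi => ?_
      rw [mem_range] at hi
      have := sum_alternating_normSq_geom_sum_mul_zpow hζ hp (m := 2 * (i : ℤ) - q)
        (by rw [abs_lt]; omega)
      rw [← mul_zero (q.choose i / 2 ^ q : ℂ), ← this, mul_sum]
      exact sum_congr rfl fun k _ => by ring
    exact_mod_cast this
  simp only [Polynomial.eval_eq_sum_range' hP, mul_sum]
  rw [sum_comm]
  refine sum_eq_zero fun q hq => ?_
  rw [← mul_zero (P.coeff q), ← hpow q (mem_range.1 hq), mul_sum]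
  exact sum_congr rfl fun k _ => by ring

lemma normSq_geom_sum_exp_mul_sin_sq (p : ℕ) (x : ℝ) :
    Complex.normSq (∑ j ∈ range p, Complex.exp (Complex.I * (2 * x : ℝ)) ^ j) * Real.sin x ^ 2
      = Real.sin (p * x) ^ 2 := by
  have h := congrArg Complex.normSq (geom_sum_mul (Complex.exp (Complex.I * (2 * x : ℝ))) p)
  have hp : Complex.exp (Complex.I * (2 * x : ℝ)) ^ p
      = Complex.exp (Complex.I * (2 * (p * x) : ℝ)) := by
    rw [← Complex.exp_nat_mul]
    congr 1
    push_cast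
    ring
  have hn : ∀ y : ℝ, Complex.normSq (Complex.exp (Complex.I * (2 * y : ℝ)) - 1)
      = 4 * Real.sin y ^ 2 := by
    intro y
    rw [Complex.normSq_eq_norm_sq, Complex.norm_exp_I_mul_ofReal_sub_one, Real.norm_eq_abs, sq_abs,
      show 2 * y / 2 = y by ring]
    ring
  rw [map_mul, hp, hn, hn] at h
  linarith

lemma sum_range_four_mul (f : ℕ → ℝ) (p : ℕ) :
    ∑ k ∈ range (4 * p), f k
      = ∑ l ∈ range p, (f (4 * l) + f (4 * l + 1) + f (4 * l + 2) + f (4 * l + 3)) := by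
  induction p with
  | zero => simp
  | succ p ih =>
    rw [sum_range_succ, ← ih, show 4 * (p + 1) = 4 * p + 1 + 1 + 1 + 1 by ring, sum_range_succ,
      sum_range_succ, sum_range_succ, sum_range_succ]
    ring

lemma sin_sq_nat_mul_pi_div_four (l r : ℕ) :
    Real.sin (((4 * l + r : ℕ) : ℝ) * (Real.pi / 4)) ^ 2 = Real.sin (r * (Real.pi / 4)) ^ 2 := by
  rw [show ((4 * l + r : ℕ) : ℝ) * (Real.pi / 4) = r * (Real.pi / 4) + l * Real.pi by
    push_cast; ring, Real.sin_add_nat_mul_pi, mul_pow, ← pow_mul, mul_comm l, pow_mul]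
  simp

lemma arcsin_mul_sin_approx_lower_bound {p : ℕ} (hp : 2 ≤ p) {s : ℝ} (hs : 0 < s)
    (hs' : s ≤ 1 / 2) {P : Polynomial ℝ} (hP : P.natDegree < p) {E : ℝ}
    (hE : ∀ x ∈ Set.Icc 0 Real.pi,
      |2 * Real.arcsin (s * Real.sin x) - P.eval (Real.cos (2 * x))| ≤ E) :
    s / (10 * Real.pi * p) ≤ E := by
  have hpi := Real.pi_pos
  have hp0 : (0 : ℝ) < p := by exact_mod_cast (by omega : 0 < p)
  have hp2 : (2 : ℝ) ≤ p := by exact_mod_cast hp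
  set θ : ℝ := Real.pi / (4 * p) with hθ
  have hθ0 : 0 < θ := by positivity
  have hθp : 4 * p * θ = Real.pi := by rw [hθ]; field_simp
  have hζ := Complex.isPrimitiveRoot_exp (4 * p) (by omega)
  set ζ := Complex.exp (2 * Real.pi * Complex.I / (4 * p : ℕ)) with hζdef
  have hζk : ∀ k : ℕ, ζ ^ k = Complex.exp (Complex.I * (2 * (k * θ) : ℝ)) := by
    intro k
    rw [hζdef, ← Complex.exp_nat_mul, hθ]
    congr 1
    push_cast
    ring
  have hre : ∀ k : ℕ, (ζ ^ k).re = Real.cos (2 * (k * θ)) := by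
    intro k
    rw [hζk, mul_comm, Complex.exp_ofReal_mul_I_re]
  set W : ℕ → ℝ := fun k => Complex.normSq (∑ j ∈ range p, (ζ ^ k) ^ j) with hW
  set A : ℕ → ℝ := fun k => Real.arcsin (s * Real.sin (k * θ)) with hA
  have hWsin : ∀ k : ℕ, W k * Real.sin (k * θ) ^ 2 = Real.sin (k * (Real.pi / 4)) ^ 2 := by
    intro k
    rw [hW]
    dsimp only
    rw [hζk, normSq_geom_sum_exp_mul_sin_sq, show (p : ℝ) * (k * θ) = k * (Real.pi / 4) by
      rw [← hθp]; ring]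
  have hW0 : ∀ k, 0 ≤ W k := fun k => Complex.normSq_nonneg _
  have hzero := sum_alternating_normSq_geom_sum_mul_eval_re hζ (by omega) hP
  have hmass := sum_normSq_geom_sum hζ (by omega)
  have hupper : |∑ k ∈ range (4 * p), (-1) ^ k * W k * (2 * A k)| ≤ 4 * (p : ℝ) ^ 2 * E := by
    have : ∑ k ∈ range (4 * p), (-1) ^ k * W k * (2 * A k)
        = ∑ k ∈ range (4 * p), (-1) ^ k * W k * (2 * A k - P.eval (ζ ^ k).re) := by
      simp only [mul_sub, sum_sub_distrib]
      rw [hzero, sub_zero]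
    rw [this, ← hmass, sum_mul]
    refine (abs_sum_le_sum_abs _ _).trans (sum_le_sum fun k hk => ?_)
    have hk' : (k : ℝ) ≤ 4 * p := by exact_mod_cast (mem_range.1 hk).le
    rw [abs_mul, abs_mul, abs_neg_one_pow, one_mul, abs_of_nonneg (hW0 k), hre]
    exact mul_le_mul_of_nonneg_left (hE _ ⟨by positivity, by rw [← hθp]; gcongr⟩) (hW0 k)
  set D : ℕ → ℝ := fun l => (A (4 * l + 1) / Real.sin ((4 * l + 1 : ℕ) * θ) ^ 2
    + A (4 * l + 3) / Real.sin ((4 * l + 3 : ℕ) * θ) ^ 2) / 2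
    - A (4 * l + 2) / Real.sin ((4 * l + 2 : ℕ) * θ) ^ 2 with hD
  have hsin : ∀ k : ℕ, 0 < k → k < 4 * p → 0 < Real.sin (k * θ) := by
    intro k hk hk'
    have h1 : (0 : ℝ) < k := by exact_mod_cast hk
    have h2 : (k : ℝ) < 4 * p := by exact_mod_cast hk'
    exact Real.sin_pos_of_pos_of_lt_pi (by positivity) (by rw [← hθp]; gcongr)
  have hblock : ∀ l ∈ range p, (-1) ^ (4 * l) * W (4 * l) * (2 * A (4 * l))
      + (-1) ^ (4 * l + 1) * W (4 * l + 1) * (2 * A (4 * l + 1))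
      + (-1) ^ (4 * l + 2) * W (4 * l + 2) * (2 * A (4 * l + 2))
      + (-1) ^ (4 * l + 3) * W (4 * l + 3) * (2 * A (4 * l + 3)) = -2 * D l := by
    intro l hl
    rw [mem_range] at hl
    have h4 : ((-1 : ℝ)) ^ (4 * l) = 1 := by
      rw [pow_mul]
      norm_num
    have w0 : W (4 * l) * A (4 * l) = 0 := by
      have h := hWsin (4 * l)
      have h' := sin_sq_nat_mul_pi_div_four l 0
      simp only [add_zero, Nat.cast_zero, zero_mul, Real.sin_zero] at h'
      rw [h', zero_pow two_ne_zero, mul_eq_zero] at h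
      rcases h with h | h
      · rw [h, zero_mul]
      · rw [hA]
        dsimp only
        rw [pow_eq_zero_iff two_ne_zero] at h
        rw [h, mul_zero, Real.arcsin_zero, mul_zero]
    have w1 : W (4 * l + 1) = 1 / 2 / Real.sin ((4 * l + 1 : ℕ) * θ) ^ 2 := by
      rw [eq_div_iff (pow_pos (hsin _ (by omega) (by omega)) 2).ne', hWsin,
        sin_sq_nat_mul_pi_div_four]
      rw [Nat.cast_one, one_mul, Real.sin_pi_div_four, div_pow, Real.sq_sqrt (by norm_num)]
      norm_num
    have w2 : W (4 * l + 2) = 1 / Real.sin ((4 * l + 2 : ℕ) * θ) ^ 2 := by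
      rw [eq_div_iff (pow_pos (hsin _ (by omega) (by omega)) 2).ne', hWsin,
        sin_sq_nat_mul_pi_div_four, show ((2 : ℕ) : ℝ) * (Real.pi / 4) = Real.pi / 2 by
          push_cast; ring, Real.sin_pi_div_two, one_pow]
    have w3 : W (4 * l + 3) = 1 / 2 / Real.sin ((4 * l + 3 : ℕ) * θ) ^ 2 := by
      rw [eq_div_iff (pow_pos (hsin _ (by omega) (by omega)) 2).ne', hWsin,
        sin_sq_nat_mul_pi_div_four, show ((3 : ℕ) : ℝ) * (Real.pi / 4) = Real.pi - Real.pi / 4 by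
          push_cast; ring, Real.sin_pi_sub, Real.sin_pi_div_four, div_pow,
        Real.sq_sqrt (by norm_num)]
      norm_num
    rw [pow_succ, pow_add, pow_add, h4, w1, w2, w3, hD]
    linear_combination 2 * w0
  have hDle : ∀ l < p, s / 2 * ((1 / Real.sin ((4 * l + 1 : ℕ) * θ)
      + 1 / Real.sin ((4 * l + 3 : ℕ) * θ)) / 2 - 1 / Real.sin ((4 * l + 2 : ℕ) * θ)) ≤ D l ∧
      1 / Real.sin ((4 * l + 2 : ℕ) * θ) ≤ (1 / Real.sin ((4 * l + 1 : ℕ) * θ)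
      + 1 / Real.sin ((4 * l + 3 : ℕ) * θ)) / 2 := by
    intro l hl
    have e1 : ((4 * l + 1 : ℕ) : ℝ) * θ = (4 * l + 2 : ℕ) * θ - θ := by push_cast; ring
    have e3 : ((4 * l + 3 : ℕ) : ℝ) * θ = (4 * l + 2 : ℕ) * θ + θ := by push_cast; ring
    have h1 : 0 < ((4 * l + 2 : ℕ) : ℝ) * θ - θ := by rw [← e1]; positivity
    have h3 : ((4 * l + 2 : ℕ) : ℝ) * θ + θ < Real.pi := by
      rw [← e3, ← hθp]
      gcongr
      exact_mod_cast (by omega : 4 * l + 3 < 4 * p)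
    rw [hD, hA]
    dsimp only
    rw [e1, e3]
    exact ⟨arcsin_mul_sin_div_sq_midpoint hs hs' hθ0.le h1 h3,
      one_div_sin_le_midpoint hθ0.le h1 h3⟩
  have hDnonneg : ∀ l ∈ range p, 0 ≤ D l := by
    intro l hl
    obtain ⟨h1, h2⟩ := hDle l (mem_range.1 hl)
    exact le_trans (mul_nonneg (by positivity) (by linarith)) h1
  have hD0 : s / 2 * (1 / (10 * θ)) ≤ D 0 := by
    refine le_trans (mul_le_mul_of_nonneg_left ?_ (by positivity)) (hDle 0 (by omega)).1
    have h := one_div_sin_midpoint_gap hθ0 (by nlinarith)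
    rw [show 2 * θ - θ = (4 * 0 + 1 : ℕ) * θ by push_cast; ring,
      show 2 * θ + θ = (4 * 0 + 3 : ℕ) * θ by push_cast; ring,
      show 2 * θ = (4 * 0 + 2 : ℕ) * θ by push_cast; ring] at h
    exact h
  have hsum : D 0 ≤ ∑ l ∈ range p, D l :=
    single_le_sum hDnonneg (mem_range.2 (by omega))
  rw [sum_range_four_mul, sum_congr rfl hblock, ← mul_sum, abs_le] at hupper
  have hfin : s / 2 * (1 / (10 * θ)) = s * p / (5 * Real.pi) := by
    rw [hθ]
    field_simp
    ring
  have h5 : s * p / (5 * Real.pi) ≤ 2 * (p : ℝ) ^ 2 * E := by linarith [hupper.1]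
  rw [div_le_iff₀ (by positivity)] at h5 ⊢
  have h6 : 0 ≤ p * (E * (10 * Real.pi * p) - s) := by nlinarith
  have := nonneg_of_mul_nonneg_right h6 hp0
  linarith

lemma IsTrigPoly.continuous {n : ℕ} {T : ℝ → ℝ} (hT : IsTrigPoly n T) : Continuous T := by
  obtain ⟨a, b, h⟩ := hT
  rw [funext h]
  fun_prop

lemma IsTrigPoly.exists_even_part_eq_eval_cos {n : ℕ} {T : ℝ → ℝ} (hT : IsTrigPoly n T) :
    ∃ P : Polynomial ℝ, P.natDegree ≤ n ∧ ∀ x, (T x + T (-x)) / 2 = P.eval (Real.cos x) := by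
  obtain ⟨a, b, h⟩ := hT
  refine ⟨Polynomial.C (a 0) + ∑ k ∈ Icc 1 n,
    Polynomial.C (a k) * Polynomial.Chebyshev.T ℝ k, ?_, fun x => ?_⟩
  · refine Polynomial.natDegree_add_le_of_degree_le (by simp)
      (Polynomial.natDegree_sum_le_of_forall_le _ _ fun k hk => ?_)
    refine (Polynomial.natDegree_C_mul_le _ _).trans ?_
    rw [Polynomial.Chebyshev.natDegree_T]
    simpa using (mem_Icc.1 hk).2
  · have : ∀ k ∈ Icc 1 n, (Polynomial.C (a k) * Polynomial.Chebyshev.T ℝ k).eval (Real.cos x)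
        = ((a k * Real.cos (k * x) + b k * Real.sin (k * x))
          + (a k * Real.cos (k * -x) + b k * Real.sin (k * -x))) / 2 := by
      intro k _
      rw [Polynomial.eval_mul, Polynomial.eval_C, Polynomial.Chebyshev.T_real_cos, mul_neg,
        Real.cos_neg, Real.sin_neg, Int.cast_natCast]
      ring
    rw [h, h, Polynomial.eval_add, Polynomial.eval_C, Polynomial.eval_finsetSum,
      sum_congr rfl this, ← sum_div]
    simp only [sum_add_distrib]
    ring

end

/-- **Corollary 3.6.** There is an absolute constant `c₁ > 0` (one may take `c₁ = 1/800`) such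
that for each `b ∈ (0, π]`, any affine function `l(x) = αx + β` and every trigonometric
polynomial `T` of degree at most `n`, `max_{|x| ≤ b} ||x| + l(x) - T(x)| ≥ c₁ b / n`. -/
theorem abs_plus_linear_trig_approx_lower_bound :
    ∃ c₁ : ℝ, 0 < c₁ ∧ c₁ = 1 / 800 ∧
      ∀ b : ℝ, b ∈ Set.Ioc 0 Real.pi → ∀ n : ℕ, 1 ≤ n → ∀ α β : ℝ,
        ∀ T : ℝ → ℝ, IsTrigPoly n T →
          c₁ * b / n ≤ sSup ((fun x => |abs x + (α * x + β) - T x|) '' Set.Icc (-b) b) := by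
  refine ⟨1 / 800, by norm_num, rfl, ?_⟩
  rintro b ⟨hb0, hbpi⟩ n hn α β T hT
  have hpi := Real.pi_pos
  set E := sSup ((fun x => |abs x + (α * x + β) - T x|) '' Set.Icc (-b) b) with hEdef
  have hcont : Continuous fun x => |abs x + (α * x + β) - T x| := by
    have := hT.continuous
    fun_prop
  have hsup : ∀ x ∈ Set.Icc (-b) b, |abs x + (α * x + β) - T x| ≤ E := fun x hx =>
    le_csSup (isCompact_Icc.image hcont).bddAbove (Set.mem_image_of_mem _ hx)
  obtain ⟨P, hPdeg, hP⟩ := hT.exists_even_part_eq_eval_cos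
  have heven : ∀ x ∈ Set.Icc 0 b, |x - (P.eval (Real.cos x) - β)| ≤ E := by
    rintro x ⟨hx0, hxb⟩
    have h1 := abs_le.1 (hsup x ⟨by linarith, hxb⟩)
    have h2 := abs_le.1 (hsup (-x) ⟨by linarith, by linarith⟩)
    rw [abs_neg] at h2
    rw [abs_of_nonneg hx0] at h1 h2
    rw [← hP, abs_le]
    constructor <;> linarith [h1.1, h1.2, h2.1, h2.2]
  set s := Real.sin (b / 6) with hs
  have hs0 : 0 < s := Real.sin_pos_of_pos_of_lt_pi (by positivity) (by linarith)
  have hs1 : s ≤ 1 / 2 := by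
    rw [← Real.sin_pi_div_six]
    exact Real.sin_le_sin_of_le_of_le_pi_div_two (by linarith) (by linarith) (by linarith)
  have hsb : 2 / Real.pi * (b / 6) ≤ s := Real.mul_le_sin (by positivity) (by linarith)
  have hE := arcsin_mul_sin_approx_lower_bound (p := n + 1) (by omega) hs0 hs1
    (P := (P - Polynomial.C β).comp
      (Polynomial.C (1 - s ^ 2) + Polynomial.C (s ^ 2) * Polynomial.X)) (E := E)
    (by
      have h1 : (P - Polynomial.C β).natDegree ≤ n :=
        (Polynomial.natDegree_sub_C (p := P)).le.trans hPdeg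
      have h2 : (Polynomial.C (1 - s ^ 2) + Polynomial.C (s ^ 2) * Polynomial.X).natDegree ≤ 1 := by
        compute_degree
      exact Nat.lt_succ_of_le (Polynomial.natDegree_comp_le.trans
        ((Nat.mul_le_mul h1 h2).trans (mul_one n).le)))
    (by
      rintro x ⟨hx0, hxpi⟩
      have hu0 := Real.sin_nonneg_of_nonneg_of_le_pi hx0 hxpi
      have hu1 := Real.sin_le_one x
      have hle : Real.arcsin (s * Real.sin x) ≤ b / 6 := by
        rw [← Real.arcsin_sin (x := b / 6) (by linarith) (by linarith)]
        exact Real.arcsin_le_arcsin (by nlinarith)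
      have hge : 0 ≤ Real.arcsin (s * Real.sin x) := Real.arcsin_nonneg.2 (by positivity)
      have h := heven (2 * Real.arcsin (s * Real.sin x)) ⟨by linarith, by linarith⟩
      convert h using 3
      simp only [Polynomial.eval_comp, Polynomial.eval_sub, Polynomial.eval_add,
        Polynomial.eval_mul, Polynomial.eval_C, Polynomial.eval_X]
      congr 2
      have hsq := Real.sin_sq_add_cos_sq (Real.arcsin (s * Real.sin x))
      rw [Real.sin_arcsin (by nlinarith) (by nlinarith)] at hsq
      rw [Real.cos_two_mul, Real.cos_two_mul]
      linear_combination 2 * s ^ 2 * Real.sin_sq_add_cos_sq x - 2 * hsq)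
  have hn1 : (1 : ℝ) ≤ n := by exact_mod_cast hn
  refine le_trans ?_ hE
  have hpi2 : Real.pi ^ 2 ≤ 10 := by nlinarith [Real.pi_lt_d2]
  have hsb' : b ≤ 3 * Real.pi * s := by
    have : 2 / Real.pi * (b / 6) = b / (3 * Real.pi) := by field_simp; ring
    rw [this, div_le_iff₀ (by positivity)] at hsb
    linarith
  push_cast
  rw [div_le_div_iff₀ (by positivity) (by positivity)]
  calc 1 / 800 * b * (10 * Real.pi * (n + 1))
      ≤ 1 / 800 * (3 * Real.pi * s) * (10 * Real.pi * (n + n)) := by gcongr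
    _ = 3 / 40 * Real.pi ^ 2 * (s * n) := by ring
    _ ≤ 3 / 40 * 10 * (s * n) := by gcongr
    _ ≤ s * n := by nlinarith [mul_nonneg hs0.le (by linarith : (0 : ℝ) ≤ n)]
end
end

section
/- For each r ∈ ℕ there exists a constant c > 0 (depending only on r) such that the following holds. Let 0 < b ≤ d ≤ π, n ∈ ℕ, and let E be a 2π-periodic C^{r−1} function on ℝ with ∫_{−π}^{π} E = 0 whose r-th derivative satisfies E^{(r)}(x) = sign(x) − (1 − d/π) for x ∈ (−d, 2π−d) ∖ {0}. Let g : ℝ → ℝ be any 2π-periodic function with sup_{x∈ℝ} |g(x) − E(x)| ≤ c b^r / (2n). Then for every trigonometric polynomial T of degree ≤ n satisfying t · T^{(r+1)}(t) ≥ 0 for all |t| ≤ b, and every algebraic polynomial P of degree ≤ r, one has 2n · max_{|x| ≤ b} | g(x) + P(x) − T(x) | ≥ c b^r. -/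
noncomputable section

open Polynomial in
/-- The Markov inequality at the right endpoint of an interval of length `s`. -/
lemma abs_derivative_eval_one_le {m : ℕ} {R : ℝ[X]} (hR : R.natDegree ≤ m) {s B : ℝ}
    (hs : 0 < s) (hB : 0 < B) (hbd : ∀ x ∈ Set.Icc (1 - s) 1, |R.eval x| ≤ B) :
    |R.derivative.eval 1| ≤ 2 * m ^ 2 * B / s := by
  have key : ∀ σ : ℝ, |σ| = 1 → σ * R.derivative.eval 1 ≤ 2 * m ^ 2 * B / s := by
    intro σ hσ
    set L : ℝ[X] := C (s / 2) * X + C (1 - s / 2) with hL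
    have hLdeg : L.natDegree ≤ 1 := natDegree_linear_le
    have hQdeg : (C (σ / B) * R.comp L).degree ≤ (m : ℕ) := by
      refine natDegree_le_iff_degree_le.mp ?_
      calc (C (σ / B) * R.comp L).natDegree ≤ (R.comp L).natDegree := natDegree_C_mul_le _ _
        _ ≤ R.natDegree * L.natDegree := natDegree_comp_le
        _ ≤ m * 1 := Nat.mul_le_mul hR hLdeg
        _ = m := mul_one m
    have h := Polynomial.Chebyshev.eval_iterate_derivative_le_of_forall_abs_le_one (k := 1)
      (le_refl (1 : ℝ)) hQdeg (by
        intro x hx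
        have h1 := hbd (s / 2 * x + (1 - s / 2)) ⟨by nlinarith [hx.1], by nlinarith [hx.2]⟩
        simp only [hL, eval_mul, eval_C, eval_comp, eval_add, eval_X, abs_mul, abs_div, hσ,
          abs_of_pos hB]
        rw [one_div, inv_mul_le_iff₀ hB, mul_one]
        exact h1)
    have hT := Polynomial.Chebyshev.derivative_T_eval_one (R := ℝ) (m : ℤ)
    simp only [Function.iterate_one, hT] at h
    simp [hL, derivative_comp, eval_comp] at h
    rw [le_div_iff₀ hs]
    have e : σ / B * (s / 2 * R.derivative.eval 1) * (2 * B) = σ * R.derivative.eval 1 * s := by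
      field_simp
    nlinarith [mul_le_mul_of_nonneg_right h (by positivity : 0 ≤ 2 * B)]
  exact abs_le'.mpr ⟨by simpa using key 1 (by simp), by simpa using key (-1) (by simp)⟩

namespace IsTrigPoly

variable {n : ℕ} {T U : ℝ → ℝ}

lemma contDiff (hT : IsTrigPoly n T) {m : WithTop ℕ∞} : ContDiff ℝ m T := by
  obtain ⟨a, b, h⟩ := hT
  rw [funext h]
  fun_prop

lemma sub (hT : IsTrigPoly n T) (hU : IsTrigPoly n U) : IsTrigPoly n (fun t => T t - U t) := by
  obtain ⟨a, b, h⟩ := hT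
  obtain ⟨a', b', h'⟩ := hU
  refine ⟨fun k => a k - a' k, fun k => b k - b' k, fun t => ?_⟩
  beta_reduce
  rw [h, h', add_sub_add_comm, ← Finset.sum_sub_distrib]
  congr 1
  exact Finset.sum_congr rfl fun k _ => by ring

lemma const_mul (hT : IsTrigPoly n T) (c : ℝ) : IsTrigPoly n (fun t => c * T t) := by
  obtain ⟨a, b, h⟩ := hT
  refine ⟨fun k => c * a k, fun k => c * b k, fun t => ?_⟩
  beta_reduce
  rw [h, mul_add, Finset.mul_sum]
  congr 1
  exact Finset.sum_congr rfl fun k _ => by ring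

lemma const (n : ℕ) (c : ℝ) : IsTrigPoly n (fun _ => c) :=
  ⟨fun k => if k = 0 then c else 0, fun _ => 0, fun t => by
    simp only [if_true, left_eq_add]
    refine Finset.sum_eq_zero fun k hk => ?_
    have : k ≠ 0 := by have := (Finset.mem_Icc.mp hk).1; omega
    simp [this]⟩

lemma comp_add_const (hT : IsTrigPoly n T) (s : ℝ) : IsTrigPoly n (fun t => T (t + s)) := by
  obtain ⟨a, b, h⟩ := hT
  refine ⟨fun k => a k * Real.cos (k * s) + b k * Real.sin (k * s),
    fun k => b k * Real.cos (k * s) - a k * Real.sin (k * s), fun t => ?_⟩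
  beta_reduce
  rw [h]
  congr 1
  · simp
  · refine Finset.sum_congr rfl fun k _ => ?_
    rw [mul_add, Real.cos_add, Real.sin_add]
    ring

lemma hasDerivAt_of_eq {a b : ℕ → ℝ}
    (h : ∀ t, T t = a 0 + ∑ k ∈ Finset.Icc 1 n,
      (a k * Real.cos (k * t) + b k * Real.sin (k * t))) (t : ℝ) :
    HasDerivAt T (∑ k ∈ Finset.Icc 1 n,
      (k * b k * Real.cos (k * t) + -(k * a k) * Real.sin (k * t))) t := by
  rw [funext h]
  refine HasDerivAt.const_add _ (HasDerivAt.fun_sum fun k _ => ?_)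
  have hk : HasDerivAt (fun t : ℝ => (k : ℝ) * t) k t := by
    simpa using (hasDerivAt_id t).const_mul (k : ℝ)
  exact ((hk.cos.const_mul (a k)).fun_add (hk.sin.const_mul (b k))).congr_deriv (by ring)

lemma deriv (hT : IsTrigPoly n T) : IsTrigPoly n (deriv T) := by
  obtain ⟨a, b, h⟩ := hT
  refine ⟨fun k => k * b k, fun k => -(k * a k), fun t => ?_⟩
  rw [(hasDerivAt_of_eq h t).deriv]
  simp

lemma iteratedDeriv (hT : IsTrigPoly n T) (m : ℕ) : IsTrigPoly n (iteratedDeriv m T) := by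
  induction m with
  | zero => simpa using hT
  | succ m ih =>
    rw [iteratedDeriv_succ]
    exact ih.deriv

open Polynomial in
/-- The odd part of a trigonometric polynomial is `sin t * p (cos t)`, with `p 1` its derivative
at the origin. -/
lemma exists_odd_part (hn : 1 ≤ n) (hT : IsTrigPoly n T) :
    ∃ p : ℝ[X], p.natDegree ≤ n - 1 ∧ p.eval 1 = _root_.deriv T 0 ∧
      ∀ t, Real.sin t * p.eval (Real.cos t) = (T t - T (-t)) / 2 := by
  obtain ⟨a, b, h⟩ := hT
  refine ⟨∑ k ∈ Finset.Icc 1 n, C (b k) * Polynomial.Chebyshev.U ℝ ((k : ℤ) - 1), ?_, ?_, ?_⟩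
  · refine natDegree_sum_le_of_forall_le _ _ fun k hk => (natDegree_C_mul_le _ _).trans ?_
    rw [Polynomial.Chebyshev.natDegree_U]
    have := Finset.mem_Icc.mp hk
    omega
  · rw [(hasDerivAt_of_eq h 0).deriv, eval_finsetSum]
    refine Finset.sum_congr rfl fun k _ => ?_
    simp [Polynomial.Chebyshev.U_eval_one, mul_comm]
  · intro t
    rw [h, h, add_sub_add_left_eq_sub, ← Finset.sum_sub_distrib, eval_finsetSum, Finset.mul_sum,
      Finset.sum_div]
    refine Finset.sum_congr rfl fun k _ => ?_
    have := Polynomial.Chebyshev.U_real_cos t ((k : ℤ) - 1)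
    simp only [Int.cast_sub, Int.cast_natCast, Int.cast_one, sub_add_cancel] at this
    simp only [eval_mul, eval_C, mul_neg, Real.cos_neg, Real.sin_neg, ← this]
    ring

open Polynomial in
/-- A Bernstein-type inequality at the midpoint of an arc. -/
lemma abs_deriv_zero_le (hn : 1 ≤ n) (hT : IsTrigPoly n T) {β M : ℝ} (hβ : 0 < β)
    (hβπ : β ≤ Real.pi) (hM : 0 < M) (hbd : ∀ t, |t| ≤ β → |T t| ≤ M) :
    |_root_.deriv T 0| ≤ 5 * n * M / β := by
  obtain ⟨p, hpdeg, hp1, hp⟩ := exists_odd_part hn hT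
  set s := 1 - Real.cos β with hs
  have hπ := Real.pi_pos
  have hsβ : 2 / Real.pi ^ 2 * β ^ 2 ≤ s := by
    have := Real.cos_le_one_sub_mul_cos_sq (x := β) (by rwa [abs_of_pos hβ])
    linarith
  have hs0 : 0 < s := lt_of_lt_of_le (by positivity) hsβ
  have hRdeg : ((1 - X ^ 2) * p ^ 2 : ℝ[X]).natDegree ≤ 2 * n := by
    have h1 : (1 - X ^ 2 : ℝ[X]).natDegree ≤ 2 := by compute_degree
    have h2 : (p ^ 2).natDegree ≤ 2 * (n - 1) :=
      (natDegree_pow_le).trans (Nat.mul_le_mul_left 2 hpdeg)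
    have := natDegree_mul_le (p := (1 - X ^ 2 : ℝ[X])) (q := p ^ 2)
    omega
  have key := abs_derivative_eval_one_le hRdeg hs0 (pow_pos hM 2) (by
    intro x hx
    have hx1 : -1 ≤ x := by linarith [hx.1, Real.neg_one_le_cos β]
    have hcos := Real.cos_arccos hx1 hx.2
    have hle : Real.arccos x ≤ β := by
      rw [← Real.arccos_cos hβ.le hβπ]
      exact Real.arccos_le_arccos (by linarith [hx.1])
    have habs : |Real.arccos x| ≤ β := by rwa [abs_of_nonneg (Real.arccos_nonneg x)]
    have hpt := hp (Real.arccos x)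
    have b1 := abs_le.mp (hbd _ habs)
    have b2 := abs_le.mp (hbd (-Real.arccos x) (by rwa [abs_neg]))
    have hval : ((1 - X ^ 2) * p ^ 2 : ℝ[X]).eval x
        = (Real.sin (Real.arccos x) * p.eval (Real.cos (Real.arccos x))) ^ 2 := by
      rw [mul_pow, Real.sin_sq, hcos]
      simp
    rw [hval, hpt, abs_of_nonneg (sq_nonneg _)]
    exact sq_le_sq' (by linarith [b1.1, b2.2]) (by linarith [b1.2, b2.1]))
  have hder : (derivative ((1 - X ^ 2) * p ^ 2 : ℝ[X])).eval 1 = -2 * (_root_.deriv T 0) ^ 2 := by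
    simp [derivative_mul, hp1, one_add_one_eq_two]
  rw [hder, abs_mul, abs_of_nonneg (sq_nonneg (_root_.deriv T 0)), le_div_iff₀ hs0] at key
  norm_num at key
  have hπ4 : Real.pi < 3.15 := Real.pi_lt_d2
  have h25 : (_root_.deriv T 0) ^ 2 * β ^ 2 ≤ 25 * n ^ 2 * M ^ 2 := by
    have h1 : (_root_.deriv T 0) ^ 2 * (2 / Real.pi ^ 2 * β ^ 2) ≤ 4 * n ^ 2 * M ^ 2 := by
      nlinarith [mul_le_mul_of_nonneg_left hsβ (sq_nonneg (_root_.deriv T 0))]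
    have h2 : (_root_.deriv T 0) ^ 2 * β ^ 2
        = (_root_.deriv T 0) ^ 2 * (2 / Real.pi ^ 2 * β ^ 2) * (Real.pi ^ 2 / 2) := by
      field_simp
    have h3 : Real.pi ^ 2 / 2 ≤ 5 := by nlinarith
    rw [h2]
    have h4 : (0 : ℝ) ≤ n ^ 2 * M ^ 2 := by positivity
    calc _ ≤ 4 * n ^ 2 * M ^ 2 * 5 := mul_le_mul h1 h3 (by positivity) (by positivity)
      _ ≤ _ := by linarith
  rw [le_div_iff₀ hβ]
  refine abs_le_of_sq_le_sq' ?_ (by positivity) |>.2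
  rw [mul_pow, sq_abs]
  linarith

end IsTrigPoly

open Set MeasureTheory

lemma integral_mul_iteratedDeriv {F φ : ℝ → ℝ} {a b : ℝ} (m : ℕ) (hF : ContDiff ℝ m F)
    (hφ : ContDiff ℝ (⊤ : ℕ∞) φ) (ha : ∀ j, iteratedDeriv j φ a = 0)
    (hb : ∀ j, iteratedDeriv j φ b = 0) :
    ∫ x in a..b, F x * iteratedDeriv m φ x
      = (-1) ^ m * ∫ x in a..b, iteratedDeriv m F x * φ x := by
  induction m generalizing F with
  | zero => simp
  | succ m ih =>
    have hF1 : Differentiable ℝ F := hF.differentiable (by simp)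
    have hF' : ContDiff ℝ m (deriv F) :=
      ((contDiff_succ_iff_deriv (n := (m : WithTop ℕ∞))).mp (by exact_mod_cast hF)).2.2
    have hdφ : Differentiable ℝ (iteratedDeriv m φ) :=
      hφ.differentiable_iteratedDeriv m (by exact_mod_cast WithTop.coe_lt_top _)
    have hcφ : Continuous (iteratedDeriv (m + 1) φ) :=
      hφ.continuous_iteratedDeriv (m + 1) (by exact_mod_cast le_top)
    have hparts := intervalIntegral.integral_mul_deriv_eq_deriv_mul (a := a) (b := b)
      (u := F) (v := iteratedDeriv m φ) (u' := deriv F) (v' := iteratedDeriv (m + 1) φ)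
      (fun x _ => (hF1 x).hasDerivAt)
      (fun x _ => by rw [iteratedDeriv_succ]; exact (hdφ x).hasDerivAt)
      (hF'.continuous.intervalIntegrable _ _) (hcφ.intervalIntegrable _ _)
    rw [hparts, ha, hb, ih hF', iteratedDeriv_succ', pow_succ]
    ring

/-- Moving all derivatives onto a test function, for a function whose top derivative exists only
away from the origin. -/
lemma abs_integral_mul_eq {F W φ : ℝ → ℝ} {a b : ℝ} (hab : a ≤ b) {m : ℕ} (hF : ContDiff ℝ m F)
    (hW : ∀ x ∈ Ioo a b, x ≠ 0 → HasDerivAt (iteratedDeriv m F) (W x) x)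
    (hWi : IntervalIntegrable W volume a b)
    (hφ : ContDiff ℝ (⊤ : ℕ∞) φ) (ha : ∀ j, iteratedDeriv j φ a = 0)
    (hb : ∀ j, iteratedDeriv j φ b = 0) :
    |∫ x in a..b, W x * φ x| = |∫ x in a..b, F x * iteratedDeriv (m + 1) φ x| := by
  have hφ' : ContDiff ℝ (⊤ : ℕ∞) (deriv φ) := (contDiff_infty_iff_deriv.mp hφ).2
  have hφd : Differentiable ℝ φ := (contDiff_infty_iff_deriv.mp hφ).1
  have hfc : Continuous (iteratedDeriv m F) := hF.continuous_iteratedDeriv' m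
  have hWφ : IntervalIntegrable (fun x => W x * φ x) volume a b :=
    hWi.mul_continuousOn hφ.continuous.continuousOn
  have hfφ : IntervalIntegrable (fun x => iteratedDeriv m F x * deriv φ x) volume a b :=
    (hfc.mul hφ'.continuous).intervalIntegrable _ _
  have h1 := MeasureTheory.integral_eq_of_hasDerivAt_off_countable
    (fun x => iteratedDeriv m F x * φ x) (fun x => W x * φ x + iteratedDeriv m F x * deriv φ x)
    (a := a) (b := b) (countable_singleton (0 : ℝ)) (hfc.mul hφ.continuous).continuousOn
    (fun x hx => by
      rw [min_eq_left hab, max_eq_right hab] at hx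
      exact (hW x hx.1 hx.2).fun_mul (hφd x).hasDerivAt)
    (hWφ.add hfφ)
  have ha0 : φ a = 0 := by simpa using ha 0
  have hb0 : φ b = 0 := by simpa using hb 0
  rw [intervalIntegral.integral_add hWφ hfφ, ha0, hb0] at h1
  have h2 := integral_mul_iteratedDeriv (a := a) (b := b) m hF hφ'
    (fun j => by rw [← iteratedDeriv_succ']; exact ha _)
    (fun j => by rw [← iteratedDeriv_succ']; exact hb _)
  rw [iteratedDeriv_succ', h2, abs_mul, abs_pow, abs_neg, abs_one, one_pow, one_mul,
    ← abs_neg (∫ x in a..b, W x * φ x)]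
  congr 1
  linarith

/-- A bump function together with the bound it gives for the mean of a top-order derivative. -/
lemma exists_bump (m : ℕ) : ∃ (ψ : ℝ → ℝ) (K : ℝ), 0 < K ∧ Continuous ψ ∧ (∀ x, 0 ≤ ψ x) ∧
    (∀ x, ψ x ≤ 1) ∧ (∀ x, |x| ≤ 1 / 2 → ψ x = 1) ∧
    ∀ (F W : ℝ → ℝ) (x₀ ρ ε : ℝ), 0 < ρ → ContDiff ℝ m F →
      (∀ x ∈ Ioo (x₀ - ρ) (x₀ + ρ), x ≠ 0 → HasDerivAt (iteratedDeriv m F) (W x) x) →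
      IntervalIntegrable W volume (x₀ - ρ) (x₀ + ρ) →
      (∀ x ∈ Icc (x₀ - ρ) (x₀ + ρ), |F x| ≤ ε) →
      |∫ x in (x₀ - ρ)..(x₀ + ρ), W x * ψ (ρ⁻¹ * (x - x₀))| ≤ K * (ε / ρ ^ (m + 1)) * ρ := by
  let B : ContDiffBump (0 : ℝ) := ⟨1 / 2, 3 / 4, by norm_num, by norm_num⟩
  have hB : ContDiff ℝ (⊤ : ℕ∞) (B : ℝ → ℝ) := B.contDiff
  have hvan : ∀ j, ∀ x : ℝ, 3 / 4 < |x| → iteratedDeriv j B x = 0 := by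
    intro j x hx
    have hev : (B : ℝ → ℝ) =ᶠ[nhds x] fun _ => 0 := by
      have : ∀ᶠ y in nhds x, 3 / 4 < |y| := continuous_abs.continuousAt.eventually_const_lt hx
      filter_upwards [this] with y hy
      exact B.zero_of_le_dist (by simpa [B] using hy.le)
    rw [hev.iteratedDeriv_eq j]
    simp
  have hcont : Continuous (iteratedDeriv (m + 1) B) :=
    hB.continuous_iteratedDeriv (m + 1) (by exact_mod_cast le_top)
  obtain ⟨L, hL⟩ := isCompact_Icc.exists_bound_of_continuousOn (s := Icc (-1 : ℝ) 1)
    hcont.continuousOn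
  have hL0 : 0 ≤ L := (norm_nonneg _).trans (hL 0 (by simp))
  refine ⟨B, 2 * L + 1, by positivity, B.continuous, fun x => B.nonneg, fun x => B.le_one,
    fun x hx => B.one_of_mem_closedBall (by simpa [B] using hx), ?_⟩
  intro F W x₀ ρ ε hρ hF hW hWi hFε
  have hε : 0 ≤ ε := (abs_nonneg _).trans (hFε x₀ ⟨by linarith, by linarith⟩)
  set φ : ℝ → ℝ := fun x => B (ρ⁻¹ * (x - x₀)) with hφdef
  have hφ : ContDiff ℝ (⊤ : ℕ∞) φ := hB.comp (by fun_prop)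
  have hφj : ∀ j x, iteratedDeriv j φ x = ρ⁻¹ ^ j * iteratedDeriv j B (ρ⁻¹ * (x - x₀)) := by
    intro j x
    have h1 := iteratedDeriv_comp_sub_const j (fun z => B (ρ⁻¹ * z)) x₀
    have h2 := iteratedDeriv_comp_const_mul (n := j) (f := B)
      (hB.of_le (by exact_mod_cast le_top)) ρ⁻¹
    rw [hφdef, h1, h2]
  have hab : x₀ - ρ ≤ x₀ + ρ := by linarith
  have e1 : ρ⁻¹ * (x₀ - ρ - x₀) = -1 := by field_simp; ring
  have e2 : ρ⁻¹ * (x₀ + ρ - x₀) = 1 := by field_simp; ring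
  rw [abs_integral_mul_eq (φ := φ) hab hF hW hWi hφ
    (fun j => by rw [hφj, e1, hvan j _ (by norm_num), mul_zero])
    (fun j => by rw [hφj, e2, hvan j _ (by norm_num), mul_zero])]
  have hbound := intervalIntegral.norm_integral_le_of_norm_le_const (a := x₀ - ρ) (b := x₀ + ρ)
    (f := fun x => F x * iteratedDeriv (m + 1) φ x) (C := ε * (ρ⁻¹ ^ (m + 1) * L)) (by
      intro x hx
      rw [uIoc_of_le hab] at hx
      rw [norm_mul, hφj, norm_mul, norm_pow, Real.norm_of_nonneg (inv_nonneg.mpr hρ.le)]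
      have hx' : ρ⁻¹ * (x - x₀) ∈ Icc (-1 : ℝ) 1 := by
        rw [← e1, ← e2]
        constructor <;> gcongr
        · exact hx.1.le
        · exact hx.2
      gcongr
      · exact hFε x ⟨hx.1.le, hx.2⟩
      · exact hL _ hx')
  rw [Real.norm_eq_abs] at hbound
  refine hbound.trans ?_
  rw [show x₀ + ρ - (x₀ - ρ) = 2 * ρ by ring, abs_of_pos (by positivity), inv_pow, div_eq_mul_inv]
  have : 0 ≤ ε * (ρ ^ (m + 1))⁻¹ * ρ := by positivity
  nlinarith

/-- If a function is small and its top-order derivative increases up to the origin and decreases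
afterwards, then the increments of its penultimate derivative are small. -/
lemma exists_increment_bound (m : ℕ) : ∃ K : ℝ, 0 < K ∧ ∀ (F W : ℝ → ℝ) (b ε : ℝ), 0 < b →
    ContDiff ℝ m F → (∀ x ∈ Ioo (-b) b, x ≠ 0 → HasDerivAt (iteratedDeriv m F) (W x) x) →
    IntervalIntegrable W volume (-b) b → (∀ x ∈ Icc (-b) b, |F x| ≤ ε) →
    MonotoneOn W (Ioc (-b) 0) → AntitoneOn W (Ioo 0 b) →
    ∀ x ∈ Icc (-(3 * b / 8)) (3 * b / 8), ∀ y ∈ Icc (-(3 * b / 8)) (3 * b / 8),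
      |iteratedDeriv m F y - iteratedDeriv m F x| ≤ K * ε / b ^ m := by
  obtain ⟨ψ, K, hK, hψc, hψ0, hψ1, hψI, hψK⟩ := exists_bump m
  refine ⟨4 * 8 ^ (m + 1) * K, by positivity, ?_⟩
  intro F W b ε hb hF hW hWi hFε hmono hanti
  have hε : 0 ≤ ε := (abs_nonneg _).trans (hFε 0 ⟨by linarith, by linarith⟩)
  have hbump : ∀ x₀ ρ, 0 < ρ → -b ≤ x₀ - ρ → x₀ + ρ ≤ b →
      |∫ x in (x₀ - ρ)..(x₀ + ρ), W x * ψ (ρ⁻¹ * (x - x₀))| ≤ K * (ε / ρ ^ (m + 1)) * ρ := by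
    intro x₀ ρ hρ h1 h2
    refine hψK F W x₀ ρ ε hρ hF (fun x hx => hW x ⟨by linarith [hx.1], by linarith [hx.2]⟩)
      (hWi.mono_set ?_) (fun x hx => hFε x ⟨by linarith [hx.1], by linarith [hx.2]⟩)
    rw [uIcc_of_le (by linarith), uIcc_of_le (by linarith)]
    exact Icc_subset_Icc h1 h2
  have hψρ : ∀ x₀ ρ : ℝ, Continuous fun x => ψ (ρ⁻¹ * (x - x₀)) := fun x₀ ρ => by fun_prop
  set η := K * (ε / (b / 8) ^ (m + 1)) with hη
  have hη0 : 0 ≤ η := by positivity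
  have hlow : ∀ x₀ w, -b ≤ x₀ - b / 8 → x₀ + b / 8 ≤ b →
      (∀ x ∈ Ioo (x₀ - b / 8) (x₀ + b / 8), W x ≤ w) → -η ≤ w := by
    intro x₀ w h1 h2 hw
    by_contra! hcon
    have hρ : 0 < b / 8 := by positivity
    have hB := (abs_le.mp (hbump x₀ (b / 8) hρ h1 h2)).1
    have hle : ∫ x in (x₀ - b / 8)..(x₀ + b / 8), W x * ψ ((b / 8)⁻¹ * (x - x₀))
        ≤ ∫ x in (x₀ - b / 8)..(x₀ + b / 8), w * ψ ((b / 8)⁻¹ * (x - x₀)) := by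
      refine intervalIntegral.integral_mono_on_of_le_Ioo (by linarith)
        ((hWi.mono_set ?_).mul_continuousOn (hψρ _ _).continuousOn)
        (((hψρ _ _).const_mul w).intervalIntegrable _ _)
        fun x hx => mul_le_mul_of_nonneg_right (hw x hx) (hψ0 _)
      rw [uIcc_of_le (by linarith), uIcc_of_le (by linarith)]
      exact Icc_subset_Icc h1 h2
    have hI : b / 8 ≤ ∫ x in (x₀ - b / 8)..(x₀ + b / 8), ψ ((b / 8)⁻¹ * (x - x₀)) := by
      calc b / 8 = ∫ x in (x₀ - b / 16)..(x₀ + b / 16), (1 : ℝ) := by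
            rw [intervalIntegral.integral_const, smul_eq_mul]; ring
        _ = ∫ x in (x₀ - b / 16)..(x₀ + b / 16), ψ ((b / 8)⁻¹ * (x - x₀)) := by
            refine intervalIntegral.integral_congr fun x hx => ?_
            rw [uIcc_of_le (by linarith)] at hx
            refine (hψI _ ?_).symm
            rw [abs_mul, abs_of_pos (by positivity), inv_mul_le_iff₀ hρ, abs_le]
            constructor <;> linarith [hx.1, hx.2]
        _ ≤ _ := intervalIntegral.integral_mono_interval (by linarith) (by linarith)
            (by linarith) (Filter.Eventually.of_forall fun x => hψ0 _)
            ((hψρ _ _).intervalIntegrable _ _)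
    rw [intervalIntegral.integral_const_mul] at hle
    have : w * ∫ x in (x₀ - b / 8)..(x₀ + b / 8), ψ ((b / 8)⁻¹ * (x - x₀)) ≤ w * (b / 8) :=
      mul_le_mul_of_nonpos_left hI (by linarith)
    nlinarith
  have hright : -η ≤ W (3 * b / 4) := by
    refine hlow (7 * b / 8) _ (by linarith) (by linarith) fun x hx => ?_
    exact hanti ⟨by linarith, by linarith⟩ ⟨by linarith [hx.1], by linarith [hx.2]⟩
      (by linarith [hx.1])
  have hleft : -η ≤ W (-(3 * b / 4)) := by
    refine hlow (-(7 * b / 8)) _ (by linarith) (by linarith) fun x hx => ?_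
    exact hmono ⟨by linarith [hx.1], by linarith [hx.2]⟩ ⟨by linarith, by linarith⟩
      (by linarith [hx.2])
  have hWη : ∀ x ∈ Icc (-(3 * b / 4)) (3 * b / 4), 0 ≤ W x + η := by
    intro x hx
    rcases le_or_gt x 0 with h0 | h0
    · linarith [hmono ⟨by linarith, by linarith⟩ ⟨by linarith [hx.1], h0⟩ hx.1]
    · linarith [hanti ⟨h0, by linarith [hx.2]⟩ ⟨by linarith, by linarith⟩ hx.2]
  have hsub : ∀ x y, -b ≤ x → x ≤ y → y ≤ b → IntervalIntegrable W volume x y := by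
    intro x y h1 h2 h3
    refine hWi.mono_set ?_
    rw [uIcc_of_le h2, uIcc_of_le (by linarith)]
    exact Icc_subset_Icc h1 h3
  set R := 3 * b / 4 with hR
  have hR0 : 0 < R := by positivity
  set φ : ℝ → ℝ := fun x => ψ (R⁻¹ * (x - 0)) with hφ
  have hφc : Continuous φ := hψρ 0 R
  have hmain : ∫ x in (-R)..R, (W x + η) * φ x ≤ 5 / 2 * η * b := by
    have h1 : ∫ x in (-R)..R, W x * φ x ≤ η * b := by
      have h := (abs_le.mp (hbump 0 R hR0 (by linarith) (by linarith))).2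
      rw [zero_sub, zero_add] at h
      refine h.trans ?_
      have : K * (ε / R ^ (m + 1)) ≤ η := by
        rw [hη]
        gcongr
        linarith
      exact mul_le_mul this (by linarith) hR0.le hη0
    have h2 : ∫ x in (-R)..R, η * φ x ≤ ∫ x in (-R)..R, η := by
      refine intervalIntegral.integral_mono_on (by linarith)
        ((hφc.const_mul η).intervalIntegrable _ _) intervalIntegrable_const fun x _ => ?_
      exact mul_le_of_le_one_right hη0 (hψ1 _)
    rw [intervalIntegral.integral_const, smul_eq_mul] at h2
    simp only [add_mul]
    rw [intervalIntegral.integral_add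
      ((hsub _ _ (by linarith) (by linarith) (by linarith)).mul_continuousOn hφc.continuousOn)
      ((hφc.const_mul η).intervalIntegrable _ _)]
    nlinarith
  have hKη : 4 * 8 ^ (m + 1) * K * ε / b ^ m = 4 * η * b := by
    rw [hη, div_pow]
    field_simp
    ring
  have hord : ∀ x ∈ Icc (-(3 * b / 8)) (3 * b / 8), ∀ y ∈ Icc (-(3 * b / 8)) (3 * b / 8),
      x ≤ y → |iteratedDeriv m F y - iteratedDeriv m F x| ≤ 4 * η * b := by
    intro x hx y hy hxy
    have hWxy := hsub x y (by linarith [hx.1]) hxy (by linarith [hy.2])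
    rw [← MeasureTheory.integral_eq_of_hasDerivAt_off_countable (iteratedDeriv m F) W
      (countable_singleton (0 : ℝ)) (hF.continuous_iteratedDeriv' m).continuousOn
      (fun t ht => by
        rw [min_eq_left hxy, max_eq_right hxy] at ht
        exact hW t ⟨by linarith [ht.1.1, hx.1], by linarith [ht.1.2, hy.2]⟩ ht.2) hWxy]
    have hsum : ∫ t in x..y, (W t + η) = (∫ t in x..y, W t) + (y - x) * η := by
      rw [intervalIntegral.integral_add hWxy intervalIntegrable_const,
        intervalIntegral.integral_const, smul_eq_mul]
    have hpos : 0 ≤ ∫ t in x..y, (W t + η) :=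
      intervalIntegral.integral_nonneg hxy fun t ht =>
        hWη t ⟨by linarith [ht.1, hx.1], by linarith [ht.2, hy.2]⟩
    have hup : ∫ t in x..y, (W t + η) ≤ 5 / 2 * η * b := by
      calc ∫ t in x..y, (W t + η) = ∫ t in x..y, (W t + η) * φ t := by
            refine intervalIntegral.integral_congr fun t ht => ?_
            rw [uIcc_of_le hxy] at ht
            have : φ t = 1 := by
              refine hψI _ ?_
              rw [abs_mul, abs_of_pos (by positivity), inv_mul_le_iff₀ hR0, abs_le]
              constructor <;> linarith [ht.1, ht.2, hx.1, hy.2]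
            simp [this]
        _ ≤ ∫ t in (-R)..R, (W t + η) * φ t := by
            refine intervalIntegral.integral_mono_interval (by linarith [hx.1]) hxy
              (by linarith [hy.2]) ?_ (((hsub _ _ (by linarith) (by linarith)
                (by linarith)).add intervalIntegrable_const).mul_continuousOn hφc.continuousOn)
            filter_upwards [ae_restrict_mem measurableSet_Ioc] with t ht
            exact mul_nonneg (hWη t ⟨ht.1.le, ht.2⟩) (hψ0 _)
        _ ≤ _ := hmain
    have hηb : 0 ≤ η * b := by positivity
    have hlen : (y - x) * η ≤ b * η :=
      mul_le_mul_of_nonneg_right (by linarith [hx.1, hy.2]) hη0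
    have hlen0 : 0 ≤ (y - x) * η := mul_nonneg (by linarith) hη0
    rw [abs_le]
    constructor <;> nlinarith
  intro x hx y hy
  rw [hKη]
  rcases le_total x y with h | h
  · exact hord x hx y hy h
  · rw [abs_sub_comm]
    exact hord y hy x hx h

/-- A trigonometric polynomial of degree `n` whose increments follow those of `|x| + q x` up to an
error `b / (128 n)` near the origin cannot exist. -/
lemma IsTrigPoly.false_of_increments_near_abs {n : ℕ} {V : ℝ → ℝ} (hV : IsTrigPoly n V)
    (hn : 1 ≤ n) {b q : ℝ} (hb : 0 < b) (hbπ : b ≤ Real.pi)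
    (hinc : ∀ x ∈ Icc (-(3 * b / 8)) (3 * b / 8), ∀ y ∈ Icc (-(3 * b / 8)) (3 * b / 8),
      |V y - V x - (|y| - |x| + q * (y - x))| ≤ b / (128 * n)) : False := by
  have hn' : (1 : ℝ) ≤ n := by exact_mod_cast hn
  have hn0 : (0 : ℝ) < n := by linarith
  set h := b / (128 * n) with hh
  have hh0 : 0 < h := by positivity
  have hhb : h ≤ b / 128 := by
    rw [hh]
    exact div_le_div_of_nonneg_left hb.le (by norm_num) (by linarith)
  set A : ℝ → ℝ := fun x => (2 * h)⁻¹ * (V (x + h) - V (x + -h)) - q with hA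
  have hAT : IsTrigPoly n A :=
    (((hV.comp_add_const h).sub (hV.comp_add_const (-h))).const_mul (2 * h)⁻¹).sub
      (IsTrigPoly.const n q)
  have hAval : ∀ x, |x| ≤ b / 4 → |2 * h * A x - (|x + h| - |x - h|)| ≤ h := by
    intro x hx
    have hx' := abs_le.mp hx
    have := hinc (x + -h) ⟨by linarith, by linarith⟩ (x + h) ⟨by linarith, by linarith⟩
    have e : 2 * h * A x - (|x + h| - |x - h|)
        = V (x + h) - V (x + -h) - (|x + h| - |x + -h| + q * (x + h - (x + -h))) := by
      rw [hA, sub_eq_add_neg x h]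
      field_simp
      ring
    rwa [e]
  have hAbd : ∀ x, |x| ≤ b / 4 → |A x| ≤ 3 / 2 := by
    intro x hx
    have h1 := abs_le.mp (hAval x hx)
    have h2 : |(|x + h| - |x - h|)| ≤ 2 * h := by
      have := abs_abs_sub_abs_le_abs_sub (x + h) (x - h)
      rwa [show x + h - (x - h) = 2 * h by ring, abs_of_pos (by positivity : 0 < 2 * h)] at this
    have h3 := abs_le.mp h2
    rw [abs_le]
    constructor <;> nlinarith
  have hAr : 1 / 2 ≤ A h := by
    have h1 := abs_le.mp (hAval h (by rw [abs_of_pos hh0]; linarith))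
    rw [sub_self, abs_zero, abs_of_pos (by positivity)] at h1
    nlinarith
  have hAl : A (-h) ≤ -(1 / 2) := by
    have h1 := abs_le.mp (hAval (-h) (by rw [abs_neg, abs_of_pos hh0]; linarith))
    rw [neg_add_cancel, abs_zero, abs_of_neg (by linarith)] at h1
    nlinarith
  have hAd : Differentiable ℝ A := hAT.contDiff.differentiable one_ne_zero
  obtain ⟨ξ, hξ, hslope⟩ := exists_deriv_eq_slope A (by linarith : -h < h)
    hAd.continuous.continuousOn hAd.differentiableOn
  have hbern := (hAT.comp_add_const ξ).abs_deriv_zero_le hn (β := b / 8) (M := 3 / 2)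
    (by positivity) (by linarith) (by norm_num) (fun t ht => hAbd _ (by
      have := abs_le.mp ht
      rw [abs_le]
      constructor <;> linarith [hξ.1, hξ.2]))
  rw [deriv_comp_add_const, zero_add] at hbern
  have hup := (le_abs_self _).trans hbern
  have hdown : 1 ≤ _root_.deriv A ξ * (2 * h) := by
    rw [hslope, show h - -h = 2 * h by ring, div_mul_cancel₀ _ (by positivity)]
    linarith
  have hprod : _root_.deriv A ξ * (2 * h) ≤ 5 * n * (3 / 2) / (b / 8) * (2 * h) :=
    mul_le_mul_of_nonneg_right hup (by positivity)
  have : 5 * n * (3 / 2) / (b / 8) * (2 * h) = 15 / 16 := by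
    rw [hh]
    field_simp
    norm_num
  linarith

lemma Real.monotone_sign : Monotone Real.sign := by
  intro x y hxy
  rcases lt_trichotomy x 0 with hx | hx | hx <;> rcases lt_trichotomy y 0 with hy | hy | hy <;>
    simp [Real.sign_of_neg, Real.sign_of_pos, hx, hy] <;> linarith

lemma Real.hasDerivAt_abs_sign {x : ℝ} (hx : x ≠ 0) : HasDerivAt (fun y => |y|) (Real.sign x) x := by
  rcases lt_or_gt_of_ne hx with h | h
  · rw [Real.sign_of_neg h]
    exact hasDerivAt_abs_neg h
  · rw [Real.sign_of_pos h]
    exact hasDerivAt_abs_pos h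

/-- Increments of a continuous function with derivative `sign x + q` away from the origin. -/
lemma sub_eq_of_hasDerivAt_sign {e : ℝ → ℝ} (he : Continuous e) {b q : ℝ}
    (hd : ∀ x ∈ Ioo (-b) b, x ≠ 0 → HasDerivAt e (Real.sign x + q) x) {x y : ℝ}
    (hx : x ∈ Ioo (-b) b) (hy : y ∈ Ioo (-b) b) :
    e y - e x = |y| - |x| + q * (y - x) := by
  have h := MeasureTheory.integral_eq_of_hasDerivAt_off_countable
    (fun t => e t - |t| - q * t) (fun _ => 0) (a := x) (b := y) (countable_singleton (0 : ℝ))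
    (by fun_prop) (fun t ht => by
      have htb : t ∈ Ioo (-b) b :=
        ⟨(lt_min hx.1 hy.1).trans ht.1.1, ht.1.2.trans (max_lt hx.2 hy.2)⟩
      refine (((hd t htb ht.2).fun_sub (Real.hasDerivAt_abs_sign ht.2)).fun_sub
        ((hasDerivAt_id t).const_mul q)).congr_deriv ?_
      ring) intervalIntegrable_const
  rw [intervalIntegral.integral_zero] at h
  linarith

lemma Polynomial.iteratedDeriv_eval (p : Polynomial ℝ) (k : ℕ) :
    iteratedDeriv k (fun x => p.eval x) = fun x => (derivative^[k] p).eval x := by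
  induction k with
  | zero => simp
  | succ k ih =>
    rw [iteratedDeriv_succ, ih, Function.iterate_succ_apply']
    ext x
    exact Polynomial.deriv _

/-- **Lemma 5.3.** For each `r ∈ ℕ` there is `c = c(r) > 0` such that the following holds.
Let `0 < b ≤ d ≤ π`, let `E` be the Eulerian-type ideal spline of order `r` with knots at `-d`
and `0` (i.e. `E` is `2π`-periodic, `C^{r-1}`, `∫_{-π}^{π} E = 0` and
`E^{(r)}(x) = sign x - (1 - d/π)` on `(-d, 2π-d) \ {0}`), and let `g` be a `2π`-periodic
function with `‖g - E‖_∞ ≤ c b^r / (2n)`. Then for every trigonometric polynomial `T` of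
degree at most `n` with `t T^{(r+1)}(t) ≥ 0` for `|t| ≤ b`, and every algebraic polynomial
`P` of degree at most `r`, one has `2n max_{|x| ≤ b} |g(x) + P(x) - T(x)| ≥ c b^r`. -/
theorem perturbed_spline_trig_approx_lower_bound (r : ℕ) (hr : 1 ≤ r) :
    ∃ c : ℝ, 0 < c ∧
      ∀ b d : ℝ, 0 < b → b ≤ d → d ≤ Real.pi →
      ∀ n : ℕ, 1 ≤ n →
      ∀ E : ℝ → ℝ,
        (∀ x : ℝ, E (x + 2 * Real.pi) = E x) →
        ContDiff ℝ (r - 1 : ℕ) E →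
        (∫ x in (-Real.pi)..Real.pi, E x) = 0 →
        (∀ x ∈ Set.Ioo (-d) (2 * Real.pi - d), x ≠ 0 →
          HasDerivAt (iteratedDeriv (r - 1) E) (Real.sign x - (1 - d / Real.pi)) x) →
      ∀ g : ℝ → ℝ,
        (∀ x : ℝ, g (x + 2 * Real.pi) = g x) →
        (∀ x : ℝ, |g x - E x| ≤ c * b ^ r / (2 * n)) →
      ∀ T : ℝ → ℝ, IsTrigPoly n T →
        (∀ t : ℝ, |t| ≤ b → 0 ≤ t * iteratedDeriv (r + 1) T t) →
      ∀ P : Polynomial ℝ, P.degree ≤ (r : ℕ) →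
        c * b ^ r ≤
          2 * n * sSup ((fun x => |g x + P.eval x - T x|) '' Set.Icc (-b) b) := by
  obtain ⟨m, rfl⟩ : ∃ m, r = m + 1 := ⟨r - 1, by omega⟩
  rw [Nat.add_sub_cancel]
  obtain ⟨K, hK, hinc⟩ := exists_increment_bound m
  refine ⟨1 / (128 * K), by positivity, ?_⟩
  intro b d hb hbd hdπ n hn E _ hE _ hE' g _ hgE T hT hsign P hP
  set c := 1 / (128 * K) with hc
  have hn' : (1 : ℝ) ≤ n := by exact_mod_cast hn
  have hn0 : (0 : ℝ) < n := by linarith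
  by_contra! hcon
  have hTc : ContDiff ℝ m T := hT.contDiff
  have hPc : ContDiff ℝ m (fun x => P.eval x) := by
    simpa only [Polynomial.coe_aeval_eq_eval] using P.contDiff_aeval (𝕜 := ℝ) m
  have hEc : Continuous E := hE.continuous
  have hTc0 : Continuous T := hTc.continuous
  have hbdd : BddAbove ((fun x => |g x + P.eval x - T x|) '' Icc (-b) b) := by
    obtain ⟨L, hL⟩ := isCompact_Icc.exists_bound_of_continuousOn (s := Icc (-b) b)
      (f := fun x => E x + P.eval x - T x) (by fun_prop)
    refine ⟨c * b ^ (m + 1) / (2 * n) + L, ?_⟩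
    rintro _ ⟨x, hx, rfl⟩
    have := abs_add_le (g x - E x) (E x + P.eval x - T x)
    rw [show g x - E x + (E x + P.eval x - T x) = g x + P.eval x - T x by ring] at this
    exact this.trans (add_le_add (hgE x) (hL x hx))
  set F : ℝ → ℝ := fun x => E x + P.eval x - T x with hFdef
  have hFε : ∀ x ∈ Icc (-b) b, |F x| ≤ c * b ^ (m + 1) / n := by
    intro x hx
    have h1 := le_csSup hbdd (mem_image_of_mem _ hx)
    have h2 : sSup ((fun x => |g x + P.eval x - T x|) '' Icc (-b) b)
        ≤ c * b ^ (m + 1) / (2 * n) := by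
      rw [le_div_iff₀ (by positivity)]
      linarith
    have h3 := abs_sub (g x + P.eval x - T x) (g x - E x)
    rw [show g x + P.eval x - T x - (g x - E x) = F x by rw [hFdef]; ring] at h3
    have h4 : c * b ^ (m + 1) / n = c * b ^ (m + 1) / (2 * n) + c * b ^ (m + 1) / (2 * n) := by
      field_simp
      norm_num
    rw [h4]
    exact h3.trans (add_le_add (h1.trans h2) (hgE x))
  have hFc : ContDiff ℝ m F := (hE.add hPc).sub hTc
  have hFm : iteratedDeriv m F = fun x => iteratedDeriv m E x
      + (Polynomial.derivative^[m] P).eval x - iteratedDeriv m T x := by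
    ext x
    rw [hFdef, iteratedDeriv_fun_sub (hE.add hPc).contDiffAt hTc.contDiffAt,
      iteratedDeriv_fun_add hE.contDiffAt hPc.contDiffAt, Polynomial.iteratedDeriv_eval]
  obtain ⟨p, hp⟩ : ∃ p : ℝ, Polynomial.derivative^[m + 1] P = Polynomial.C p := by
    refine ⟨_, Polynomial.eq_C_of_natDegree_eq_zero ?_⟩
    have h1 := Polynomial.natDegree_iterate_derivative P (m + 1)
    have h2 := Polynomial.natDegree_le_iff_degree_le.mpr hP
    omega
  set q := p - (1 - d / Real.pi) with hq
  have hed : ∀ x ∈ Ioo (-b) b, x ≠ 0 → HasDerivAt (fun x => iteratedDeriv m E x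
      + (Polynomial.derivative^[m] P).eval x) (Real.sign x + q) x := by
    intro x hx hx0
    have h1 := hE' x ⟨by linarith [hx.1], by linarith [hx.2]⟩ hx0
    have h2 := (Polynomial.derivative^[m] P).hasDerivAt x
    rw [← Function.iterate_succ_apply' Polynomial.derivative m P, hp, Polynomial.eval_C] at h2
    exact (h1.fun_add h2).congr_deriv (by rw [hq]; ring)
  set S := iteratedDeriv (m + 1) T with hS
  have hSd : Differentiable ℝ S := (hT.iteratedDeriv (m + 1)).contDiff.differentiable one_ne_zero
  have hsign' : ∀ t, |t| ≤ b → 0 ≤ t * deriv S t := by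
    intro t ht
    rw [hS, ← iteratedDeriv_succ]
    exact hsign t ht
  have hSmono : MonotoneOn S (Icc 0 b) := by
    refine monotoneOn_of_deriv_nonneg (convex_Icc 0 b) hSd.continuous.continuousOn
      hSd.differentiableOn fun t ht => ?_
    rw [interior_Icc] at ht
    exact nonneg_of_mul_nonneg_right (hsign' t (by rw [abs_of_pos ht.1]; exact ht.2.le)) ht.1
  have hSanti : AntitoneOn S (Icc (-b) 0) := by
    refine antitoneOn_of_deriv_nonpos (convex_Icc (-b) 0) hSd.continuous.continuousOn
      hSd.differentiableOn fun t ht => ?_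
    rw [interior_Icc] at ht
    have := hsign' t (by rw [abs_of_neg ht.2]; linarith [ht.1])
    nlinarith [ht.2]
  have key := hinc F (fun x => Real.sign x + q - S x) b (c * b ^ (m + 1) / n) hb hFc
    (fun x hx hx0 => by
      rw [hFm]
      refine (hed x hx hx0).fun_sub ?_
      rw [hS, iteratedDeriv_succ]
      exact ((hT.iteratedDeriv m).contDiff.differentiable one_ne_zero x).hasDerivAt)
    ((Real.monotone_sign.intervalIntegrable.add intervalIntegrable_const).sub
      (hSd.continuous.intervalIntegrable _ _))
    hFε
    (fun x hx y hy hxy => by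
      have h1 := Real.monotone_sign hxy
      have h2 := hSanti ⟨hx.1.le, hx.2⟩ ⟨hy.1.le, hy.2⟩ hxy
      beta_reduce
      linarith)
    (fun x hx y hy hxy => by
      have h2 := hSmono ⟨hx.1.le, hx.2.le⟩ ⟨hy.1.le, hy.2.le⟩ hxy
      beta_reduce
      rw [Real.sign_of_pos hx.1, Real.sign_of_pos hy.1]
      linarith)
  have hconst : K * (c * b ^ (m + 1) / n) / b ^ m = b / (128 * n) := by
    rw [hc]
    field_simp
    ring
  rw [hconst] at key
  refine (hT.iteratedDeriv m).false_of_increments_near_abs hn (q := q) hb (hbd.trans hdπ) ?_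
  intro x hx y hy
  have h1 := sub_eq_of_hasDerivAt_sign
    (e := fun x => iteratedDeriv m E x + (Polynomial.derivative^[m] P).eval x)
    ((hE.continuous_iteratedDeriv' m).add (Polynomial.continuous _)) hed
    (x := x) (y := y) ⟨by linarith [hx.1], by linarith [hx.2]⟩
    ⟨by linarith [hy.1], by linarith [hy.2]⟩
  have h2 := key x hx y hy
  rw [hFm, abs_sub_comm] at h2
  rw [← h1]
  convert h2 using 2
  ring
end
end
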